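/- Let R₀, R, τ > 0, let ν₀ be a Borel probability measure on ℝ^d supported in the closed ball B_{R₀}, and let ν be a Borel probability measure on ℝ^d with finite second moment. Let P : ℝ^d → ℝ^d be the metric projection onto the closed ball B_{R₀ + τR} and set ν̂ = P_# ν. Then for every a ∈ B_R one has (1/2)W₂²(ν̂, ν₀) − τ ∫_{ℝ^d} a·x dν̂(x) ≤ (1/2)W₂²(ν, ν₀) − τ ∫_{ℝ^d} a·x dν(x). -/

import Mathlib

open MeasureTheory
open scoped RealInnerProductSpace

noncomputable section

/-- Optimal transport cost between two Borel measures on `E` for the cost `c`. -/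
def Wcost {E : Type*} [MeasurableSpace E] (c : E → E → ℝ) (ν θ : Measure E) : ℝ :=
  sInf { r : ℝ | ∃ γ : Measure (E × E),
    γ.map Prod.fst = ν ∧ γ.map Prod.snd = θ ∧ r = ∫ p, c p.1 p.2 ∂γ }

/-- Squared 2-Wasserstein distance on a normed space. -/
def W2sq {E : Type*} [NormedAddCommGroup E] [MeasurableSpace E] (ν θ : Measure E) : ℝ :=
  Wcost (fun x y => ‖x - y‖ ^ 2) ν θ

/-- The metric projection onto the closed ball of radius `r` centered at the origin. -/
def ballProj {E : Type*} [NormedAddCommGroup E] [NormedSpace ℝ E] (r : ℝ) (x : E) : E :=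
  if ‖x‖ ≤ r then x else (r / ‖x‖) • x

section BallProj

theorem norm_ballProj_le_norm {E : Type*} [NormedAddCommGroup E] [NormedSpace ℝ E] {r : ℝ}
    (hr : 0 ≤ r) (x : E) : ‖ballProj r x‖ ≤ ‖x‖ := by
  unfold ballProj
  split_ifs with h
  · exact le_rfl
  · have hx : 0 < ‖x‖ := hr.trans_lt (not_le.mp h)
    rw [norm_smul, norm_div, norm_norm, div_mul_cancel₀ _ hx.ne', Real.norm_of_nonneg hr]
    exact (not_le.mp h).le

theorem measurable_ballProj {E : Type*} [NormedAddCommGroup E] [NormedSpace ℝ E]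
    [MeasurableSpace E] [BorelSpace E] [SecondCountableTopology E] (r : ℝ) :
    Measurable (ballProj r : E → E) :=
  Measurable.ite (measurableSet_le measurable_norm measurable_const) measurable_id
    ((measurable_const.div measurable_norm).smul measurable_id)

/-- Projecting `x` onto a ball whose radius exceeds `‖y‖` by at least `‖b‖` decreases
`½‖x - y‖² - ⟪b, x⟫`. -/
theorem half_norm_ballProj_sub_sq_sub_inner_le {E : Type*} [NormedAddCommGroup E]
    [InnerProductSpace ℝ E] {r : ℝ} {b y : E} (h : ‖y‖ + ‖b‖ ≤ r) (x : E) :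
    (1 / 2) * ‖ballProj r x - y‖ ^ 2 - ⟪b, ballProj r x⟫ ≤
      (1 / 2) * ‖x - y‖ ^ 2 - ⟪b, x⟫ := by
  unfold ballProj
  split_ifs with hxr
  · exact le_rfl
  · have hr : 0 ≤ r := le_trans (by positivity) h
    have hrx : r < ‖x‖ := not_le.mp hxr
    have hx : 0 < ‖x‖ := hr.trans_lt hrx
    set t := r / ‖x‖ with ht
    have htx : t * ‖x‖ = r := div_mul_cancel₀ _ hx.ne'
    have ht1 : t ≤ 1 := (div_le_one hx).mpr hrx.le
    have hyx : ⟪x, y⟫ ≤ ‖x‖ * ‖y‖ := real_inner_le_norm x y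
    have hbx : ⟪b, x⟫ ≤ ‖b‖ * ‖x‖ := real_inner_le_norm b x
    have key : ⟪x, y⟫ + ⟪b, x⟫ ≤ t * ‖x‖ ^ 2 := by
      have : ‖x‖ * (‖y‖ + ‖b‖) ≤ ‖x‖ * r := mul_le_mul_of_nonneg_left h hx.le
      rw [← htx] at this
      linarith
    rw [norm_sub_sq_real, norm_sub_sq_real, inner_smul_left, inner_smul_right, norm_smul, mul_pow,
      Real.norm_eq_abs, sq_abs, RCLike.conj_to_real]
    nlinarith [mul_le_mul_of_nonneg_left key (sub_nonneg.mpr ht1), sq_nonneg ((1 - t) * ‖x‖)]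

end BallProj

section Transport

theorem Wcost_le_integral {E : Type*} [MeasurableSpace E] {c : E → E → ℝ}
    (hc : ∀ x y, 0 ≤ c x y) {ν θ : Measure E} {γ : Measure (E × E)}
    (h₁ : γ.map Prod.fst = ν) (h₂ : γ.map Prod.snd = θ) :
    Wcost c ν θ ≤ ∫ p, c p.1 p.2 ∂γ := by
  refine csInf_le ⟨0, ?_⟩ ⟨γ, h₁, h₂, rfl⟩
  rintro _ ⟨γ', -, -, rfl⟩
  exact integral_nonneg fun p => hc p.1 p.2

theorem le_Wcost {E : Type*} [MeasurableSpace E] {c : E → E → ℝ} {ν θ : Measure E}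
    [IsProbabilityMeasure ν] [IsProbabilityMeasure θ] {m : ℝ}
    (h : ∀ γ : Measure (E × E), γ.map Prod.fst = ν → γ.map Prod.snd = θ →
      m ≤ ∫ p, c p.1 p.2 ∂γ) :
    m ≤ Wcost c ν θ := by
  refine le_csInf ⟨_, ν.prod θ, ?_, ?_, rfl⟩ ?_
  · simp
  · simp
  · rintro _ ⟨γ, h₁, h₂, rfl⟩
    exact h γ h₁ h₂

theorem W2sq_map_le_integral {E : Type*} [NormedAddCommGroup E] [MeasurableSpace E]
    [BorelSpace E] [SecondCountableTopology E] {f : E → E} (hf : Measurable f)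
    {ν θ : Measure E} {γ : Measure (E × E)}
    (h₁ : γ.map Prod.fst = ν) (h₂ : γ.map Prod.snd = θ) :
    W2sq (ν.map f) θ ≤ ∫ p, ‖f p.1 - p.2‖ ^ 2 ∂γ := by
  have hF : Measurable (Prod.map f id : E × E → E × E) := hf.prodMap measurable_id
  have h₁' : (γ.map (Prod.map f id)).map Prod.fst = ν.map f := by
    rw [← h₁, Measure.map_map measurable_fst hF, Measure.map_map hf measurable_fst]
    rfl
  have h₂' : (γ.map (Prod.map f id)).map Prod.snd = θ := by
    rw [← h₂, Measure.map_map measurable_snd hF]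
    rfl
  refine (Wcost_le_integral (fun x y => sq_nonneg ‖x - y‖) h₁' h₂').trans_eq ?_
  have hm : Measurable fun p : E × E => ‖p.1 - p.2‖ ^ 2 :=
    (measurable_fst.sub measurable_snd).norm.pow_const 2
  rw [integral_map hF.aemeasurable hm.aestronglyMeasurable]
  rfl

end Transport

/-- **Projection lemma for the JKO scheme.** Let `ν₀` be a probability measure supported in
`B_{R₀} ⊂ ℝ^d`, `ν` a probability measure with finite second moment, `P` the projection onto
`B_{R₀ + τR}`, and `ν̂ = P_#ν`. Then for every `a ∈ B_R`,
`(1/2)W₂²(ν̂, ν₀) − τ∫ a·x dν̂ ≤ (1/2)W₂²(ν, ν₀) − τ∫ a·x dν`. -/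
theorem projection_decreases_JKO_functional
    (d : ℕ) (R₀ R τ : ℝ) (hR₀ : 0 < R₀) (hR : 0 < R) (hτ : 0 < τ)
    (ν₀ ν : Measure (EuclideanSpace ℝ (Fin d)))
    [IsProbabilityMeasure ν₀] [IsProbabilityMeasure ν]
    (hsupp : ν₀ ((Metric.closedBall (0 : EuclideanSpace ℝ (Fin d)) R₀)ᶜ) = 0)
    (hmom : Integrable (fun x => ‖x‖ ^ 2) ν) :
    ∀ a ∈ Metric.closedBall (0 : EuclideanSpace ℝ (Fin d)) R,
      (1 / 2) * W2sq (ν.map (ballProj (R₀ + τ * R))) ν₀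
          - τ * ∫ x, ⟪a, x⟫ ∂(ν.map (ballProj (R₀ + τ * R)))
        ≤ (1 / 2) * W2sq ν ν₀ - τ * ∫ x, ⟪a, x⟫ ∂ν := by
  intro a ha
  set r := R₀ + τ * R with hr
  have hr0 : 0 ≤ r := by positivity
  have hP : Measurable (ballProj r : EuclideanSpace ℝ (Fin d) → _) := measurable_ballProj r
  suffices H : 2 * (τ * ∫ x, ⟪a, x⟫ ∂ν + (1 / 2) * W2sq (ν.map (ballProj r)) ν₀
      - τ * ∫ x, ⟪a, x⟫ ∂(ν.map (ballProj r))) ≤ W2sq ν ν₀ by linarith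
  refine le_Wcost fun γ h₁ h₂ => ?_
  have : IsProbabilityMeasure (γ.map Prod.fst) := h₁ ▸ ‹IsProbabilityMeasure ν›
  have : IsProbabilityMeasure γ :=
    Measure.isProbabilityMeasure_of_map Prod.fst
  have hy : ∀ᵐ p ∂γ, ‖p.2‖ ≤ R₀ := by
    have h : ∀ᵐ y ∂(γ.map Prod.snd), ‖y‖ ≤ R₀ := by
      rw [h₂, ae_iff]
      simpa [Set.compl_def] using hsupp
    exact ae_of_ae_map measurable_snd.aemeasurable h
  have hfst : MemLp (fun p : EuclideanSpace ℝ (Fin d) × EuclideanSpace ℝ (Fin d) => p.1) 2 γ := by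
    have h : MemLp id 2 (γ.map Prod.fst) := by
      rw [h₁]
      exact (memLp_two_iff_integrable_sq_norm aestronglyMeasurable_id).mpr hmom
    exact h.comp_of_map measurable_fst.aemeasurable
  have hsnd : MemLp (fun p : EuclideanSpace ℝ (Fin d) × EuclideanSpace ℝ (Fin d) => p.2) 2 γ :=
    MemLp.of_bound measurable_snd.aestronglyMeasurable R₀ hy
  have hproj : MemLp (fun p : EuclideanSpace ℝ (Fin d) × EuclideanSpace ℝ (Fin d) =>
      ballProj r p.1) 2 γ :=
    hfst.mono (hP.comp measurable_fst).aestronglyMeasurable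
      (ae_of_all _ fun p => norm_ballProj_le_norm hr0 p.1)
  have hW := W2sq_map_le_integral hP h₁ h₂
  have hinner : Measurable fun x : EuclideanSpace ℝ (Fin d) => ⟪a, x⟫ := by fun_prop
  have e₁ : ∫ x, ⟪a, x⟫ ∂ν = ∫ p, ⟪a, p.1⟫ ∂γ := by
    rw [← h₁, integral_map measurable_fst.aemeasurable hinner.aestronglyMeasurable]
  have e₂ : ∫ x, ⟪a, x⟫ ∂(ν.map (ballProj r)) = ∫ p, ⟪a, ballProj r p.1⟫ ∂γ := by
    rw [← h₁, Measure.map_map hP measurable_fst, integral_map (hP.comp measurable_fst).aemeasurable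
      hinner.aestronglyMeasurable]
    rfl
  have i₁ := ((hfst.sub hsnd).integrable_norm_pow two_ne_zero).const_mul (1 / 2)
  have i₂ := ((hproj.sub hsnd).integrable_norm_pow two_ne_zero).const_mul (1 / 2)
  have j₁ := ((hfst.integrable one_le_two).const_inner (𝕜 := ℝ) a).const_mul τ
  have j₂ := ((hproj.integrable one_le_two).const_inner (𝕜 := ℝ) a).const_mul τ
  have hmono := integral_mono_ae (i₂.sub j₂) (i₁.sub j₁) <| by
    filter_upwards [hy] with p hp
    have hb : ‖p.2‖ + ‖τ • a‖ ≤ r := by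
      rw [norm_smul, Real.norm_of_nonneg hτ.le]
      exact add_le_add hp (mul_le_mul_of_nonneg_left (mem_closedBall_zero_iff.mp ha) hτ.le)
    simpa [inner_smul_left] using half_norm_ballProj_sub_sq_sub_inner_le hb p.1
  rw [integral_sub' i₂ j₂, integral_sub' i₁ j₁] at hmono
  simp only [integral_const_mul, Pi.sub_apply] at hmono
  rw [e₁, e₂]
  linarith

end
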